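/- Every countably generated L-algebra over a countable field k embeds into a simple L-algebra generated by two elements. -/

import Mathlib

/-- A bundled L-algebra over k: a k-vector space with two bilinear operations
≺ (`pre`) and ≻ (`suc`) satisfying (x≻y)≺z = x≻(y≺z). -/
structure LAlg (k : Type) [Field k] where
  carrier : Type
  [addCommGroup : AddCommGroup carrier]
  [module : Module k carrier]
  pre : carrier →ₗ[k] carrier →ₗ[k] carrier
  suc : carrier →ₗ[k] carrier →ₗ[k] carrier
  entangle : ∀ x y z : carrier, pre (suc x y) z = suc x (pre y z)

attribute [instance] LAlg.addCommGroup LAlg.module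

variable {k : Type} [Field k]

/-- A homomorphism of L-algebras: a k-linear map preserving both operations. -/
def IsLHom (A B : LAlg k) (f : A.carrier →ₗ[k] B.carrier) : Prop :=
  (∀ x y : A.carrier, f (A.pre x y) = B.pre (f x) (f y)) ∧
  (∀ x y : A.carrier, f (A.suc x y) = B.suc (f x) (f y))

/-- `LGen A s`: the set s generates A as an L-algebra, i.e. the only subspace
containing s and closed under both operations is the whole of A. -/
def LGen (A : LAlg k) (s : Set A.carrier) : Prop :=
  ∀ p : Submodule k A.carrier, s ⊆ p →
    (∀ a ∈ p, ∀ b ∈ p, A.pre a b ∈ p ∧ A.suc a b ∈ p) → ∀ x : A.carrier, x ∈ p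

/-- An ideal of an L-algebra: a subspace I with a≺b, b≺a, a≻b, b≻a ∈ I for all
a ∈ I and b in the algebra. -/
def IsLIdeal (A : LAlg k) (I : Submodule k A.carrier) : Prop :=
  ∀ a ∈ I, ∀ b : A.carrier,
    A.pre a b ∈ I ∧ A.pre b a ∈ I ∧ A.suc a b ∈ I ∧ A.suc b a ∈ I

/-- A simple L-algebra: no ideals other than 0 and itself. -/
def LSimple (A : LAlg k) : Prop :=
  ∀ I : Submodule k A.carrier, IsLIdeal A I → I = ⊥ ∨ I = ⊤

/-- A countably generated L-algebra over a countable field is countable. -/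
theorem countable_of_gen (k : Type) [Field k] [Countable k] (A : LAlg k)
    (s : Set A.carrier) (hs : s.Countable) (hg : LGen A s) : Countable A.carrier := by
  let step : Set A.carrier → Set A.carrier := fun T =>
    T ∪ (Set.image2 (fun x y => x + y) T T ∪ (Set.image2 (fun (c : k) y => c • y) Set.univ T ∪
      (Set.image2 (fun x y => A.pre x y) T T ∪ Set.image2 (fun x y => A.suc x y) T T)))
  let S : ℕ → Set A.carrier := fun n => Nat.rec (s ∪ {0}) (fun _ T => step T) n
  have hS : ∀ n, S (n+1) = step (S n) := fun n => rfl
  have hc : ∀ n, (S n).Countable := by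
    intro n
    induction n with
    | zero => exact hs.union (Set.countable_singleton 0)
    | succ n ih =>
      rw [hS]
      exact ih.union ((ih.image2 ih _).union (((Set.countable_univ).image2 ih _).union
        ((ih.image2 ih _).union (ih.image2 ih _))))
  have hmono : Monotone S := monotone_nat_of_le_succ (fun n x hx => Or.inl hx)
  have key : ∀ x y, (∃ n, x ∈ S n) → (∃ n, y ∈ S n) → ∃ n, x ∈ S n ∧ y ∈ S n := by
    rintro x y ⟨n, hn⟩ ⟨m, hm⟩
    exact ⟨max n m, hmono (le_max_left _ _) hn, hmono (le_max_right _ _) hm⟩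
  let p : Submodule k A.carrier :=
    { carrier := {x | ∃ n, x ∈ S n}
      zero_mem' := ⟨0, Or.inr rfl⟩
      add_mem' := by
        intro x y hx hy
        obtain ⟨n, h1, h2⟩ := key x y hx hy
        exact ⟨n+1, Or.inr (Or.inl ⟨x, h1, y, h2, rfl⟩)⟩
      smul_mem' := by
        rintro c x ⟨n, h⟩
        exact ⟨n+1, Or.inr (Or.inr (Or.inl ⟨c, trivial, x, h, rfl⟩))⟩ }
  have hp : ∀ x, x ∈ p := by
    apply hg p
    · intro x hx
      exact ⟨0, Or.inl hx⟩
    · intro x hx y hy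
      obtain ⟨n, h1, h2⟩ := key x y hx hy
      exact ⟨⟨n+1, Or.inr (Or.inr (Or.inr (Or.inl ⟨x, h1, y, h2, rfl⟩)))⟩,
        ⟨n+1, Or.inr (Or.inr (Or.inr (Or.inr ⟨x, h1, y, h2, rfl⟩)))⟩⟩
  rw [← Set.countable_univ_iff]
  refine (Set.countable_iUnion hc).mono ?_
  intro x _
  exact Set.mem_iUnion.2 (hp x)

/-- The quotient of an L-algebra by an ideal. -/
noncomputable def LQuot {k : Type} [Field k] (M : LAlg k) (I : Submodule k M.carrier)
    (hI : IsLIdeal M I) : LAlg k where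
  carrier := M.carrier ⧸ I
  pre := I.liftQ
    (LinearMap.mk₂ k (fun x y => I.liftQ (I.mkQ ∘ₗ M.pre x)
        (fun z hz => by simpa using (hI z hz x).2.1) y)
      (by intro a b c; induction c using Submodule.Quotient.induction_on; simp)
      (by intro a b c; induction c using Submodule.Quotient.induction_on; simp)
      (by intros; simp) (by intros; simp))
    (by
      intro x hx
      ext y
      simpa using (hI x hx y).1)
  suc := I.liftQ
    (LinearMap.mk₂ k (fun x y => I.liftQ (I.mkQ ∘ₗ M.suc x)
        (fun z hz => by simpa using (hI z hz x).2.2.2) y)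
      (by intro a b c; induction c using Submodule.Quotient.induction_on; simp)
      (by intro a b c; induction c using Submodule.Quotient.induction_on; simp)
      (by intros; simp) (by intros; simp))
    (by
      intro x hx
      ext y
      simpa using (hI x hx y).2.2.1)
  entangle := by
    intro x y z
    induction x using Submodule.Quotient.induction_on
    induction y using Submodule.Quotient.induction_on
    induction z using Submodule.Quotient.induction_on
    exact congrArg I.mkQ (M.entangle _ _ _)

theorem reduce_max (k : Type) [Field k] (A M : LAlg k) (e : M.carrier) (he : e ≠ 0)
    (hg : LGen M {e}) (f : A.carrier →ₗ[k] M.carrier) (hf : IsLHom A M f)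
    (hid : ∀ I : Submodule k M.carrier, IsLIdeal M I → ∀ a, a ≠ 0 → f a ∈ I → e ∈ I) :
    ∃ (B : LAlg k) (f : A.carrier →ₗ[k] B.carrier),
      Function.Injective f ∧ IsLHom A B f ∧ LSimple B ∧
      ∃ b1 b2 : B.carrier, LGen B {b1, b2} := by
  have htop : ∀ J : Submodule k M.carrier, IsLIdeal M J → e ∈ J → J = ⊤ := by
    intro J hJ heJ
    rw [Submodule.eq_top_iff']
    apply hg J (by simpa using heJ)
    intro a ha b _
    exact ⟨(hJ a ha b).1, (hJ a ha b).2.2.1⟩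
  obtain ⟨I, hI⟩ := zorn_le₀ {I : Submodule k M.carrier | IsLIdeal M I ∧ e ∉ I} (by
    intro c hc hch
    rcases c.eq_empty_or_nonempty with rfl | hne
    · refine ⟨⊥, ⟨?_, by simpa using he⟩, by simp⟩
      intro a ha b
      rw [Submodule.mem_bot] at ha
      subst ha
      simp
    · refine ⟨sSup c, ⟨?_, ?_⟩, fun z hz => le_sSup hz⟩
      · intro a ha b
        rw [Submodule.mem_sSup_of_directed hne hch.directedOn] at ha
        obtain ⟨J, hJ, haJ⟩ := ha
        have h := (hc hJ).1 a haJ b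
        have hle := le_sSup hJ
        exact ⟨hle h.1, hle h.2.1, hle h.2.2.1, hle h.2.2.2⟩
      · intro ha
        rw [Submodule.mem_sSup_of_directed hne hch.directedOn] at ha
        obtain ⟨J, hJ, haJ⟩ := ha
        exact (hc hJ).2 haJ)
  obtain ⟨hIi, hIe⟩ := hI.prop
  let q : M.carrier →ₗ[k] (LQuot M I hIi).carrier := I.mkQ
  have hqs : Function.Surjective q := I.mkQ_surjective
  have hq0 : ∀ x, q x = 0 ↔ x ∈ I := fun x => Submodule.Quotient.mk_eq_zero I
  have hqp : ∀ x y, (LQuot M I hIi).pre (q x) (q y) = q (M.pre x y) := fun x y => rfl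
  have hqc : ∀ x y, (LQuot M I hIi).suc (q x) (q y) = q (M.suc x y) := fun x y => rfl
  refine ⟨LQuot M I hIi, q ∘ₗ f, ?_, ⟨?_, ?_⟩, ?_, q e, q e, ?_⟩
  · rw [injective_iff_map_eq_zero]
    intro a ha
    by_contra h0
    exact hIe (hid I hIi a h0 ((hq0 _).1 ha))
  · intro x y
    simp only [LinearMap.comp_apply, hf.1, hqp]
  · intro x y
    simp only [LinearMap.comp_apply, hf.2, hqc]
  · intro J hJ
    have hcom : IsLIdeal M (J.comap q) := by
      intro a ha b
      have h := hJ (q a) ha (q b)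
      simp only [hqp, hqc] at h
      exact h
    have hle : I ≤ J.comap q := by
      intro x hx
      rw [Submodule.mem_comap, (hq0 x).2 hx]
      exact J.zero_mem
    by_cases heJ : e ∈ J.comap q
    · right
      have := htop _ hcom heJ
      rw [Submodule.eq_top_iff'] at this ⊢
      intro x
      obtain ⟨y, rfl⟩ := hqs x
      exact this y
    · left
      have h2 := hI.le_of_ge ⟨hcom, heJ⟩ hle
      rw [Submodule.eq_bot_iff]
      intro x hx
      obtain ⟨y, rfl⟩ := hqs x
      exact (hq0 y).2 (h2 hx)
  · intro p hp hcl x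
    obtain ⟨y, rfl⟩ := hqs x
    refine hg (p.comap q) ?_ ?_ y
    · intro z hz
      rw [Set.mem_singleton_iff] at hz
      subst hz
      exact hp (by simp)
    · intro a ha b hb
      have h := hcl (q a) ha (q b) hb
      simp only [hqp, hqc] at h
      exact h

/-- The algebra generated by the operators `· ≺ z`. -/
abbrev QAlg {k : Type} [Field k] (A : LAlg k) : Subalgebra k (Module.End k A.carrier) :=
  Algebra.adjoin k (Set.range A.pre.flip)

theorem suc_comm {k : Type} [Field k] (A : LAlg k) (q : QAlg A) (x y : A.carrier) :
    A.suc x (q • y) = q • A.suc x y := by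
  obtain ⟨q, hq⟩ := q
  change A.suc x (q y) = q (A.suc x y)
  induction hq using Algebra.adjoin_induction generalizing y with
  | mem q h =>
    obtain ⟨z, rfl⟩ := h
    exact (A.entangle x y z).symm
  | algebraMap c => simp [Module.algebraMap_end_apply]
  | add a b _ _ ha hb => simp [ha, hb]
  | mul a b _ _ ha hb => simp [ha, hb]

/-- underlying space of the large algebra -/
abbrev BigM {k : Type} [Field k] (A : LAlg k) : Type := A.carrier × (ℕ →₀ QAlg A)

instance instTowerA {k : Type} [Field k] (A : LAlg k) : IsScalarTower k (QAlg A) A.carrier :=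
  ⟨fun _ _ _ => rfl⟩

instance instCommA {k : Type} [Field k] (A : LAlg k) : SMulCommClass (QAlg A) k A.carrier :=
  ⟨fun q c x => map_smul q.1 c x⟩

instance instTowerQ {k : Type} [Field k] (A : LAlg k) :
    IsScalarTower k (QAlg A) (ℕ →₀ QAlg A) :=
  ⟨fun c q x => by ext1 j; exact smul_mul_assoc c q (x j)⟩

instance instCommQ {k : Type} [Field k] (A : LAlg k) :
    SMulCommClass (QAlg A) k (ℕ →₀ QAlg A) :=
  ⟨fun q c x => by ext1 j; exact mul_smul_comm c q (x j)⟩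

noncomputable instance instModM {k : Type} [Field k] (A : LAlg k) : Module (QAlg A) (BigM A) :=
  Prod.instModule

instance instTowerM {k : Type} [Field k] (A : LAlg k) : IsScalarTower k (QAlg A) (BigM A) :=
  Prod.isScalarTower

instance instCommM {k : Type} [Field k] (A : LAlg k) : SMulCommClass (QAlg A) k (BigM A) :=
  Prod.smulCommClass

/-- the table `ε_i ≻ ε_j` -/
noncomputable def tbl {k : Type} [Field k] (A : LAlg k) (a : ℕ → A.carrier) : ℕ → ℕ → BigM A
  | 0, j => (0, Finsupp.single (j+1) 1)
  | i+1, 0 => (a i, 0)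
  | _+1, _+1 => 0

noncomputable def bigW {k : Type} [Field k] (A : LAlg k) (a : ℕ → A.carrier)
    (φ : ℕ → A.carrier →ₗ[k] k) (l : QAlg A →ₗ[k] k) : BigM A →ₗ[k] (ℕ → BigM A) :=
  LinearMap.pi (fun j =>
    ((φ j).smulRight ((0, Finsupp.single 0 1) : BigM A)) ∘ₗ LinearMap.fst k _ _ +
    (Finsupp.linearCombination k (fun i => tbl A a i j)) ∘ₗ Finsupp.mapRange.linearMap l ∘ₗ
      LinearMap.snd k _ _)

noncomputable def bigSuc {k : Type} [Field k] (A : LAlg k) (a : ℕ → A.carrier)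
    (φ : ℕ → A.carrier →ₗ[k] k) (l : QAlg A →ₗ[k] k) : BigM A →ₗ[k] BigM A →ₗ[k] BigM A :=
  LinearMap.mk₂ k (fun x y => ((A.suc x.1 y.1, 0) : BigM A) +
      Finsupp.linearCombination (QAlg A) (bigW A a φ l x) y.2)
    (by
      intro x x' y
      have := congrArg (fun F => F y.2) ((Finsupp.bilinearCombination (QAlg A) k).map_add
        (bigW A a φ l x) (bigW A a φ l x'))
      simp only [Finsupp.bilinearCombination_apply, LinearMap.add_apply] at this
      rw [map_add, this, Prod.fst_add, map_add, LinearMap.add_apply]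
      ext1 <;> simp <;> abel)
    (by
      intro c x y
      have := congrArg (fun F => F y.2) ((Finsupp.bilinearCombination (QAlg A) k).map_smul c
        (bigW A a φ l x))
      simp only [Finsupp.bilinearCombination_apply, LinearMap.smul_apply] at this
      rw [map_smul, this, Prod.smul_fst, map_smul, LinearMap.smul_apply]
      ext1 <;> simp)
    (by
      intro x y y'
      rw [Prod.snd_add, map_add, Prod.fst_add, map_add]
      ext1 <;> simp <;> abel)
    (by
      intro c x y
      rw [Prod.smul_snd, LinearMap.map_smul_of_tower, Prod.smul_fst, map_smul]
      ext1 <;> simp)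

/-- The operator `· ≺ z` as an element of `QAlg`. -/
noncomputable def rho {k : Type} [Field k] (A : LAlg k) : A.carrier →ₗ[k] QAlg A :=
  LinearMap.codRestrict (Subalgebra.toSubmodule (QAlg A)) A.pre.flip
    (fun z => Algebra.subset_adjoin ⟨z, rfl⟩)

noncomputable def bigAlg {k : Type} [Field k] (A : LAlg k) (a : ℕ → A.carrier)
    (φ : ℕ → A.carrier →ₗ[k] k) (l : QAlg A →ₗ[k] k) : LAlg k where
  carrier := BigM A
  pre := LinearMap.mk₂ k (fun x z => rho A z.1 • x)
    (by intros; simp only [smul_add])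
    (by intro c x z; exact smul_comm _ _ _)
    (by intro x y z; rw [Prod.fst_add, map_add]; exact add_smul _ _ x)
    (by intro c x z; simp only [Prod.smul_fst, map_smul, smul_assoc])
  suc := bigSuc A a φ l
  entangle := by
    intro x y z
    simp only [LinearMap.mk₂_apply, bigSuc]
    rw [Prod.smul_snd, map_smul, Prod.smul_fst, suc_comm, smul_add]
    congr 1
    ext1 <;> simp

theorem embed_simple_two_generated (k : Type) [Field k] [Countable k] (A : LAlg k)
    (hA : ∃ s : Set A.carrier, s.Countable ∧ LGen A s) :
    ∃ (B : LAlg k) (f : A.carrier →ₗ[k] B.carrier),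
      Function.Injective f ∧ IsLHom A B f ∧ LSimple B ∧
      ∃ b1 b2 : B.carrier, LGen B {b1, b2} := by
  obtain ⟨s, hs, hg⟩ := hA
  have hcount := countable_of_gen k A s hs hg
  rcases subsingleton_or_nontrivial A.carrier with hsub | hnt
  · refine ⟨A, LinearMap.id, fun _ _ h => h, ⟨fun _ _ => rfl, fun _ _ => rfl⟩, ?_, 0, 0, ?_⟩
    · intro I _
      left
      exact Subsingleton.elim _ _
    · intro p _ _ x
      rw [Subsingleton.elim x 0]
      exact p.zero_mem
  obtain ⟨a, ha⟩ := exists_surjective_nat A.carrier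
  have hφ : ∀ x : A.carrier, ∃ φ : A.carrier →ₗ[k] k, x ≠ 0 → φ x ≠ 0 := by
    intro x
    by_contra! h
    have h0 : x = 0 := (Module.forall_dual_apply_eq_zero_iff k x).1 (fun φ => (h φ).2)
    exact (h 0).1 h0
  choose φ hφ using fun j => hφ (a j)
  obtain ⟨l, hl⟩ := (Algebra.linearMap k (QAlg A)).exists_leftInverse_of_injective
    (LinearMap.ker_eq_bot.2 (algebraMap k (QAlg A)).injective)
  have hl1 : l 1 = 1 := by
    have := LinearMap.congr_fun hl 1
    simpa using this
  let M := bigAlg A a φ l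
  let e : ℕ → M.carrier := fun j => ((0, Finsupp.single j 1) : BigM A)
  let f : A.carrier →ₗ[k] M.carrier := LinearMap.inl k A.carrier (ℕ →₀ QAlg A)
  have hee : ∀ i j, M.suc (e i) (e j) = tbl A a i j := by
    intro i j
    change ((A.suc 0 0, 0) : BigM A) +
      Finsupp.linearCombination (QAlg A) (bigW A a φ l (e i)) (Finsupp.single j 1) = _
    have hz : ((0, 0) : BigM A) = 0 := rfl
    simp [bigW, e, hl1, hz]
  have hae : ∀ x j, M.suc (f x) (e j) = φ j x • e 0 := by
    intro x j
    change ((A.suc x 0, 0) : BigM A) +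
      Finsupp.linearCombination (QAlg A) (bigW A a φ l (f x)) (Finsupp.single j 1) = _
    have hz : ((0, 0) : BigM A) = 0 := rfl
    have hw : bigW A a φ l (x, 0) j = φ j x • ((0, Finsupp.single 0 1) : BigM A) := by
      simp [bigW]
    rw [Finsupp.linearCombination_single, one_smul, map_zero, hz, zero_add]
    exact hw
  have hpre : ∀ x z, M.pre x (f z) = (rho A z • (show BigM A from x) : BigM A) := fun x z => rfl
  have hf : IsLHom A M f := by
    constructor
    · intro x y
      rw [hpre]
      refine Prod.ext ?_ ?_
      · rfl
      · exact (smul_zero (rho A y)).symm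
    · intro x y
      change _ = ((A.suc x y, 0) : BigM A) +
        Finsupp.linearCombination (QAlg A) (bigW A a φ l (f x)) 0
      rw [map_zero, add_zero]
      rfl
  refine reduce_max k A M (e 0) ?_ ?_ f hf ?_
  · intro h
    have h2 := congrArg (fun m : BigM A => m.2 0) h
    simp [e] at h2
    exact one_ne_zero h2
  · intro p hp hcl
    have he0 : e 0 ∈ p := hp rfl
    have he : ∀ j, e j ∈ p := by
      intro j
      induction j with
      | zero => exact he0
      | succ j ih =>
        have h := (hcl _ he0 _ ih).2
        rw [hee] at h
        exact h
    have hAp : ∀ x, f x ∈ p := by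
      intro x
      obtain ⟨i, rfl⟩ := ha x
      have h := (hcl _ (he (i+1)) _ he0).2
      rw [hee] at h
      exact h
    have hQ : ∀ q : Module.End k A.carrier, ∀ hq : q ∈ QAlg A, ∀ m : BigM A,
        (m : M.carrier) ∈ p → (((⟨q, hq⟩ : QAlg A) • m : BigM A) : M.carrier) ∈ p := by
      intro q hq
      induction hq using Algebra.adjoin_induction with
      | mem q h =>
        obtain ⟨z, rfl⟩ := h
        intro m hm
        exact (hcl m hm (f z) (hAp z)).1
      | algebraMap c =>
        intro m hm
        have h : ((c • m : BigM A) : M.carrier) ∈ p := p.smul_mem c hm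
        rw [← algebraMap_smul (QAlg A) c m] at h
        exact h
      | add x y hx hy h1 h2 =>
        intro m hm
        have h := p.add_mem (h1 m hm) (h2 m hm)
        have h3 := add_smul (⟨x, hx⟩ : QAlg A) ⟨y, hy⟩ m
        exact h3 ▸ h
      | mul x y hx hy h1 h2 =>
        intro m hm
        have h := h1 _ (h2 m hm)
        have h3 := mul_smul (⟨x, hx⟩ : QAlg A) ⟨y, hy⟩ m
        exact h3 ▸ h
    have hN : ∀ n : ℕ →₀ QAlg A, (((0, n) : BigM A) : M.carrier) ∈ p := by
      intro n
      induction n using Finsupp.induction_linear with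
      | zero => exact p.zero_mem
      | add x y hx hy =>
        have h := p.add_mem hx hy
        have h3 : ((0, x + y) : BigM A) = (0, x) + (0, y) := by simp
        rw [h3]
        exact h
      | single j q =>
        have h := hQ q.1 q.2 _ (he j)
        have h3 : ((0, Finsupp.single j q) : BigM A) = q • (0, Finsupp.single j 1) := by simp
        rw [h3]
        exact h
    intro x
    have h := p.add_mem (hAp x.1) (hN x.2)
    have h3 : ∀ y : BigM A, ((y.1, 0) : BigM A) + (0, y.2) = y := fun y => by simp
    exact (h3 x) ▸ h
  · intro I hI x hx hxI
    obtain ⟨j, rfl⟩ := ha x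
    have h := (hI _ hxI (e j)).2.2.1
    rw [hae] at h
    exact (I.smul_mem_iff (hφ j hx)).1 h
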